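/- arXiv:2311.16856 — 3 statements merged into one kernel-verified Lean document; each statement's English description precedes it below -/
import Mathlib

section
/- Let N ≥ 1, let h : Fin N → ℝ^D be a family of node representations, let W be a real D × D' matrix, let v₁, v₂ ∈ ℝ^{D'}, and let φ : ℝ → ℝ be monotone nondecreasing. Define the GAT scoring function e(i, j) = φ(⟨W^T h_i, v₁⟩ + ⟨W^T h_j, v₂⟩). Then there exists an index j_max ∈ Fin N such that for every i ∈ Fin N and every j ∈ Fin N, e(i, j_max) ≥ e(i, j). In particular, the GAT scoring function computes only static attention. -/
open Matrix

/-- GAT computes only static attention.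
For node representations `h : Fin N → ℝ^D`, weight matrix `W : ℝ^{D×D'}`,
vectors `v₁ v₂ : ℝ^{D'}` and a monotone nonlinearity `φ`, the GAT score
`e i j = φ(⟨Wᵀ hᵢ, v₁⟩ + ⟨Wᵀ hⱼ, v₂⟩) = φ(hᵢW ⬝ v₁ + hⱼW ⬝ v₂)` admits a
single "highest coefficient" index `jmax` valid for all queries `i`. -/
theorem gat_static_attention
    (N D D' : ℕ) (hN : 1 ≤ N)
    (h : Fin N → Fin D → ℝ)
    (W : Matrix (Fin D) (Fin D') ℝ)
    (v₁ v₂ : Fin D' → ℝ)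
    (φ : ℝ → ℝ) (hφ : Monotone φ) :
    ∃ jmax : Fin N, ∀ i j : Fin N,
      φ (Matrix.vecMul (h i) W ⬝ᵥ v₁ + Matrix.vecMul (h j) W ⬝ᵥ v₂) ≤
        φ (Matrix.vecMul (h i) W ⬝ᵥ v₁ + Matrix.vecMul (h jmax) W ⬝ᵥ v₂) := by
  have : Nonempty (Fin N) := ⟨⟨0, hN⟩⟩
  obtain ⟨jmax, hmax⟩ := Finite.exists_max fun j => Matrix.vecMul (h j) W ⬝ᵥ v₂
  exact ⟨jmax, fun i j => hφ (add_le_add_right (hmax j) _)⟩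
end

section
/- Let N ≥ 1 and let h : Fin N → ℝ^D be an injective family of node representations. Let F be a family of functions f : ℝ^{2D} → ℝ with the uniform approximation property: for every continuous g : ℝ^{2D} → ℝ, every compact set K ⊆ ℝ^{2D}, and every ε > 0, there exists f ∈ F with sup_{x ∈ K} |f(x) − g(x)| < ε. Then F computes dynamic attention: for every mapping φ : Fin N → Fin N there exists f ∈ F such that for every i ∈ Fin N and every j ∈ Fin N with j ≠ φ(i), f([h_i ∥ h_{φ(i)}]) > f([h_i ∥ h_j]), where [x ∥ y] ∈ ℝ^{2D} denotes the concatenation of x and y. -/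
theorem exists_continuous_eq_zero_eq_one_of_finite {X : Type*} [TopologicalSpace X] [NormalSpace X]
    [T1Space X] {s t : Set X} (hs : s.Finite) (ht : t.Finite) (hst : Disjoint s t) :
    ∃ g : X → ℝ, Continuous g ∧ (∀ x ∈ s, g x = 0) ∧ ∀ x ∈ t, g x = 1 := by
  obtain ⟨g, hg0, hg1, -⟩ := exists_continuous_zero_one_of_isClosed hs.isClosed ht.isClosed hst
  exact ⟨g, g.continuous, fun x hx => hg0 hx, fun x hx => hg1 hx⟩

/-- Universal approximators compute dynamic attention.
Given injective node representations `h : Fin N → ℝ^D` and a family `F` of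
scoring functions on concatenated pairs `ℝ^{2D} = ℝ^{D+D}` with the uniform
approximation property on compact sets, for every mapping `φ : Fin N → Fin N`
there is `f ∈ F` with `f [hᵢ ∥ h_{φ i}] > f [hᵢ ∥ hⱼ]` for all `i` and `j ≠ φ i`. -/
theorem universal_approximation_dynamic_attention
    (N D : ℕ) (hN : 1 ≤ N)
    (h : Fin N → Fin D → ℝ) (hinj : Function.Injective h)
    (F : Set ((Fin (D + D) → ℝ) → ℝ))
    (happrox : ∀ g : (Fin (D + D) → ℝ) → ℝ, Continuous g →
      ∀ K : Set (Fin (D + D) → ℝ), IsCompact K → ∀ ε : ℝ, 0 < ε →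
        ∃ f ∈ F, ∀ x ∈ K, |f x - g x| < ε) :
    ∀ φ : Fin N → Fin N, ∃ f ∈ F, ∀ i j : Fin N, j ≠ φ i →
      f (Fin.append (h i) (h j)) < f (Fin.append (h i) (h (φ i))) := by
  intro φ
  let pair : Fin N × Fin N → Fin (D + D) → ℝ := fun p => Fin.append (h p.1) (h p.2)
  have hpair : Function.Injective pair := fun p q hpq => by
    obtain ⟨h₁, h₂⟩ := Prod.ext_iff.mp ((Fin.appendEquiv D D).injective
      (a₁ := (h p.1, h p.2)) (a₂ := (h q.1, h q.2)) hpq)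
    exact Prod.ext (hinj h₁) (hinj h₂)
  obtain ⟨g, hg, hg0, hg1⟩ := exists_continuous_eq_zero_eq_one_of_finite
    (Set.toFinite (pair '' {p | p.2 ≠ φ p.1})) (Set.toFinite (pair '' {p | p.2 = φ p.1}))
    ((Set.disjoint_image_iff hpair).mpr (Set.disjoint_left.mpr fun _ hne heq => hne heq))
  obtain ⟨f, hfF, hf⟩ := happrox g hg (Set.range pair) (Set.finite_range pair).isCompact
    (1 / 2) one_half_pos
  refine ⟨f, hfF, fun i j hj => ?_⟩
  have hlow := hf _ (Set.mem_range_self (i, j))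
  have hhigh := hf _ (Set.mem_range_self (i, φ i))
  rw [hg0 _ (Set.mem_image_of_mem pair hj), abs_lt] at hlow
  rw [hg1 _ (Set.mem_image_of_mem pair rfl), abs_lt] at hhigh
  change f (pair (i, j)) < f (pair (i, φ i))
  linarith [hlow.2, hhigh.1]
end

section
/- Let S range over real N × D matrices, let Â be a symmetric real N × N matrix, set L = I − Â, let c > 0, and define f(S') = ‖S' − S‖_F² + c · tr((S')^T L S'). Then the gradient of f with respect to the Frobenius inner product at S' = S equals 2c L S, and for any stepsize b > 0 one step of gradient descent from S gives S − b · 2c L S = (1 − 2bc) S + 2bc Â S; in particular, with b = 1/(2c) the result is exactly Â S. Hence the GCN feature aggregation H ↦ Â H is one-step gradient descent for the graph signal denoising problem with stepsize 1/(2c). -/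
open Matrix

attribute [local instance] Matrix.frobeniusNormedAddCommGroup Matrix.frobeniusNormedSpace

/-- The bilinear form `(X, Y) ↦ tr (Xᵀ M Y)` on real matrices. -/
noncomputable def traceBilin {m n : Type*} [Fintype m] [Fintype n] (M : Matrix m m ℝ) :
    Matrix m n ℝ →ₗ[ℝ] Matrix m n ℝ →ₗ[ℝ] ℝ :=
  LinearMap.mk₂ ℝ (fun X Y => (Xᵀ * M * Y).trace)
    (fun X₁ X₂ Y => by simp [Matrix.add_mul])
    (fun a X Y => by simp)
    (fun X Y₁ Y₂ => by simp [Matrix.mul_add])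
    (fun a X Y => by simp)

/-- For symmetric `M`, the derivative of `X ↦ tr (Xᵀ M X)` at `S` is `H ↦ 2 tr (Sᵀ M H)`. -/
theorem hasFDerivAt_trace_quadratic {m n : Type*} [Fintype m] [Fintype n]
    {M : Matrix m m ℝ} (hM : M.IsSymm) (S : Matrix m n ℝ) :
    HasFDerivAt (fun X : Matrix m n ℝ => (Xᵀ * M * X).trace)
      ((2 : ℝ) • LinearMap.toContinuousLinearMap (traceBilin M S)) S := by
  have h := (traceBilin (n := n) M).toContinuousBilinearMap.hasFDerivAt_of_bilinear
    (hasFDerivAt_id S) (hasFDerivAt_id S)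
  refine h.congr_fderiv ?_
  ext H
  have hsymm : (Hᵀ * M * S).trace = (Sᵀ * M * H).trace := by
    rw [← trace_transpose]
    simp [transpose_mul, hM.eq, Matrix.mul_assoc]
  change (Sᵀ * M * H).trace + (Hᵀ * M * S).trace = 2 * (Sᵀ * M * H).trace
  rw [hsymm, two_mul]

/-- The squared distance to `a` has zero derivative at `a`. -/
theorem hasFDerivAt_norm_sub_sq_self {E : Type*} [NormedAddCommGroup E] [NormedSpace ℝ E] (a : E) :
    HasFDerivAt (fun x : E => ‖x - a‖ ^ 2) (0 : E →L[ℝ] ℝ) a :=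
  (Asymptotics.isBigO_refl _ _).hasFDerivAt one_lt_two

/-- GCN aggregation as one-step gradient descent for denoising.
With `L = I − Â` (`Â` symmetric), `c > 0`, and
`f X = ‖X − S‖_F² + c · tr (Xᵀ L X)`, the gradient of `f` (w.r.t. the Frobenius
inner product) at `S' = S` is `2c L S`; one gradient step with stepsize `b`
gives `S − b • (2c L S) = (1 − 2bc) S + 2bc Â S`, and with `b = 1/(2c)` the
result is exactly `Â S`, the GCN feature aggregation. -/
theorem gcn_aggregation_is_gradient_descent
    (N D : ℕ)
    (S : Matrix (Fin N) (Fin D) ℝ)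
    (Ahat : Matrix (Fin N) (Fin N) ℝ) (hA : Ahat.IsSymm)
    (L : Matrix (Fin N) (Fin N) ℝ) (hLdef : L = 1 - Ahat)
    (c : ℝ) (hc : 0 < c) :
    (DifferentiableAt ℝ
        (fun X : Matrix (Fin N) (Fin D) ℝ => ‖X - S‖ ^ 2 + c * (Xᵀ * L * X).trace) S ∧
      ∀ H : Matrix (Fin N) (Fin D) ℝ,
        fderiv ℝ
            (fun X : Matrix (Fin N) (Fin D) ℝ => ‖X - S‖ ^ 2 + c * (Xᵀ * L * X).trace)
            S H =
          (((2 * c) • (L * S))ᵀ * H).trace) ∧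
      (∀ b : ℝ,
        S - b • ((2 * c) • (L * S)) =
          (1 - 2 * b * c) • S + (2 * b * c) • (Ahat * S)) ∧
      S - (1 / (2 * c)) • ((2 * c) • (L * S)) = Ahat * S := by
  have hL : L.IsSymm := hLdef ▸ isSymm_one.sub hA
  have hf := (hasFDerivAt_norm_sub_sq_self S).add
    ((hasFDerivAt_trace_quadratic hL S).const_mul c)
  have hstep : ∀ b : ℝ, S - b • ((2 * c) • (L * S)) =
      (1 - 2 * b * c) • S + (2 * b * c) • (Ahat * S) := by
    intro b
    rw [hLdef, Matrix.sub_mul, Matrix.one_mul]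
    module
  refine ⟨⟨hf.differentiableAt, fun H => ?_⟩, hstep, ?_⟩
  · refine (congrArg (fun T => T H) hf.fderiv).trans ?_
    change 0 + c * (2 * (Sᵀ * L * H).trace) = _
    simp [transpose_mul, hL.eq]
    ring
  · rw [hstep]
    have hb : 2 * (1 / (2 * c)) * c = 1 := by field_simp
    rw [hb, sub_self, zero_smul, zero_add, one_smul]
end
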